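/- Exponential smallness at the optimal truncation order. For every real number x with 0 < x ≤ 1/e, setting l := ⌊1/(e·x)⌋ one has l ≥ 1 and l! · x^l ≤ e · exp(−1/(e·x)). In particular, the l-th term of a series whose terms are bounded by l!·x^l is exponentially small in 1/x at the optimal order l ∝ 1/x. -/

import Mathlib

/-- **Exponential smallness at the optimal truncation order.**
For `0 < x ≤ 1/e`, setting `l := ⌊1/(e·x)⌋`, one has `l ≥ 1` and
`l! · x^l ≤ e · exp(−1/(e·x))`. -/
theorem factorial_mul_pow_le_exp (x : ℝ) (hx : 0 < x) (hx' : x ≤ 1 / Real.exp 1) :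
    1 ≤ ⌊1 / (Real.exp 1 * x)⌋₊ ∧
      (Nat.factorial ⌊1 / (Real.exp 1 * x)⌋₊ : ℝ) * x ^ ⌊1 / (Real.exp 1 * x)⌋₊ ≤
        Real.exp 1 * Real.exp (-(1 / (Real.exp 1 * x))) := by
  have he : 0 < Real.exp 1 := Real.exp_pos 1
  have hy : 1 ≤ 1 / (Real.exp 1 * x) := by
    rw [le_div_iff₀ (by positivity), one_mul]
    rwa [le_div_iff₀ he, mul_comm] at hx'
  have hxy : x = (Real.exp 1 * (1 / (Real.exp 1 * x)))⁻¹ := by field_simp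
  generalize 1 / (Real.exp 1 * x) = y at hy hxy ⊢
  subst hxy
  have hy0 : 0 < y := by linarith
  refine ⟨Nat.le_floor (by exact_mod_cast hy), ?_⟩
  have hl : (⌊y⌋₊ : ℝ) ≤ y := Nat.floor_le hy0.le
  have hl' : y < ⌊y⌋₊ + 1 := Nat.lt_floor_add_one y
  generalize ⌊y⌋₊ = l at hl hl' ⊢
  have hfact : (l.factorial : ℝ) ≤ y ^ l :=
    calc (l.factorial : ℝ) ≤ (l : ℝ) ^ l := by exact_mod_cast Nat.factorial_le_pow l
      _ ≤ y ^ l := by gcongr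
  calc (l.factorial : ℝ) * (Real.exp 1 * y)⁻¹ ^ l
      ≤ y ^ l * (Real.exp 1 * y)⁻¹ ^ l := by gcongr
    _ = Real.exp (-l) := by
      rw [← mul_pow, mul_inv, mul_left_comm, mul_inv_cancel₀ hy0.ne', mul_one, ← Real.exp_neg,
        ← Real.exp_nat_mul, mul_neg_one]
    _ ≤ Real.exp (1 + -y) := Real.exp_le_exp.2 (by linarith)
    _ = Real.exp 1 * Real.exp (-y) := Real.exp_add _ _
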